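/- Let M be a compact metric space, let X = M^ℤ be endowed with the metric r(x,y) = Σ_{n∈ℤ} min{1/(n²+1), d(x_n,y_n)}, let μ be a Borel probability measure on X and let q > 1. Then D⁺_μ(q) ≥ limsup_{ε→0⁺} log I^{n₀(ε)}_μ(q,ε) / ((q−1) log ε), where for ε ∈ (0,1), n₀(ε) is the largest integer n ≥ 0 with ε < 1/(n²+1), and I^{n}_μ(q,ε) = ∫ μ(B^{n}(x,ε))^{q−1} dμ(x). -/

import Mathlib

open MeasureTheory Filter Topology Metric Set
open scoped ENNReal NNReal

section Defs

variable {X : Type*} [MetricSpace X] [MeasurableSpace X]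

/-- The topological support of a Borel measure on a metric space: the set of points all of whose
balls have positive measure. -/
def msupp (μ : Measure X) : Set X := {x : X | ∀ ε > 0, 0 < μ (ball x ε)}

/-- The energy function `I_μ(q, ε) = ∫_{supp μ} μ(B(x,ε))^(q-1) dμ(x)`. -/
noncomputable def energyI (μ : Measure X) (q ε : ℝ) : ℝ :=
  ∫ x in msupp μ, (μ (ball x ε)).toReal ^ (q - 1) ∂μ

/-- The lower `q`-generalized fractal dimension
`D⁻_μ(q) = liminf_{ε→0⁺} log I_μ(q,ε) / ((q-1) log ε)` (as an extended real number). -/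
noncomputable def Dlower (μ : Measure X) (q : ℝ) : EReal :=
  liminf (fun ε : ℝ =>
    ((Real.log (energyI μ q ε) / ((q - 1) * Real.log ε) : ℝ) : EReal)) (𝓝[>] (0 : ℝ))

/-- The upper `q`-generalized fractal dimension
`D⁺_μ(q) = limsup_{ε→0⁺} log I_μ(q,ε) / ((q-1) log ε)` (as an extended real number). -/
noncomputable def Dupper (μ : Measure X) (q : ℝ) : EReal :=
  limsup (fun ε : ℝ =>
    ((Real.log (energyI μ q ε) / ((q - 1) * Real.log ε) : ℝ) : EReal)) (𝓝[>] (0 : ℝ))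

/-- `∫_{supp μ} log μ(B(x,ε)) dμ(x)`, the numerator in the entropy dimension. -/
noncomputable def entNum (μ : Measure X) (ε : ℝ) : ℝ :=
  ∫ x in msupp μ, Real.log (μ (ball x ε)).toReal ∂μ

/-- The lower entropy dimension
`D⁻_μ(1) = liminf_{ε→0⁺} (∫_{supp μ} log μ(B(x,ε)) dμ(x)) / log ε`. -/
noncomputable def D1lower (μ : Measure X) : EReal :=
  liminf (fun ε : ℝ => ((entNum μ ε / Real.log ε : ℝ) : EReal)) (𝓝[>] (0 : ℝ))

/-- The upper entropy dimension
`D⁺_μ(1) = limsup_{ε→0⁺} (∫_{supp μ} log μ(B(x,ε)) dμ(x)) / log ε`. -/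
noncomputable def D1upper (μ : Measure X) : EReal :=
  limsup (fun ε : ℝ => ((entNum μ ε / Real.log ε : ℝ) : EReal)) (𝓝[>] (0 : ℝ))

/-- A measure is `T`-invariant if `μ(T⁻¹ s) = μ s` for every measurable `s`. -/
def IsInvariantMeasure (T : X → X) (μ : Measure X) : Prop :=
  ∀ s : Set X, MeasurableSet s → μ (T ⁻¹' s) = μ s

/-- `M(T)`: the set of `T`-invariant Borel probability measures on `X`. -/
def invSet (T : X → X) : Set (ProbabilityMeasure X) :=
  {μ : ProbabilityMeasure X | IsInvariantMeasure T μ.toMeasure}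

/-- A `T`-periodic measure: `μ = (1/k) ∑_{i<k} δ_{T^i x}` for a `T`-periodic point `x`
of period `k`. -/
def IsPeriodicMeasure (T : X → X) (μ : ProbabilityMeasure X) : Prop :=
  ∃ (x : X) (k : ℕ), 0 < k ∧ T^[k] x = x ∧
    μ.toMeasure = (k : ℝ≥0∞)⁻¹ • ∑ i ∈ Finset.range k, Measure.dirac (T^[i] x)

/-- The upper Hausdorff dimension of a measure:
`dim_H^+(μ) = inf {dimH E | E Borel, μ(X \ E) = 0}`. -/
noncomputable def dimHplus (μ : Measure X) : ℝ≥0∞ :=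
  ⨅ (E : Set X) (_ : MeasurableSet E) (_ : μ Eᶜ = 0), dimH E

/-- The lower Hausdorff dimension of a measure:
`dim_H^-(μ) = inf {dimH E | E Borel, μ(E) > 0}`. -/
noncomputable def dimHminus (μ : Measure X) : ℝ≥0∞ :=
  ⨅ (E : Set X) (_ : MeasurableSet E) (_ : 0 < μ E), dimH E

/-- The return time `τ_s(x) = inf {k ≥ 1 | T^k x ∈ B(x,s)}`. -/
noncomputable def tauRet (T : X → X) (s : ℝ) (x : X) : ℕ :=
  sInf {k : ℕ | 0 < k ∧ T^[k] x ∈ ball x s}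

/-- The lower recurrence rate `R̲(x) = liminf_{s→0⁺} log τ_s(x) / (-log s)`. -/
noncomputable def Rlower (T : X → X) (x : X) : EReal :=
  liminf (fun s : ℝ =>
    ((Real.log (tauRet T s x : ℝ) / (-Real.log s) : ℝ) : EReal)) (𝓝[>] (0 : ℝ))

open Classical in
/-- The lower local dimension `d̲_μ(x) = liminf_{ε→0⁺} log μ(B(x,ε)) / log ε` when all balls
around `x` have positive measure, and `+∞` otherwise. -/
noncomputable def dLoc (μ : Measure X) (x : X) : EReal :=
  if (∀ ε > 0, 0 < μ (ball x ε)) then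
    liminf (fun ε : ℝ =>
      ((Real.log (μ (ball x ε)).toReal / Real.log ε : ℝ) : EReal)) (𝓝[>] (0 : ℝ))
  else ⊤

/-- The auxiliary continuous kernel `f^ε_x(y)`: equal to `1` if `dist x y ≤ ε`, to
`2 - dist x y / ε` if `ε ≤ dist x y ≤ 2ε`, and to `0` if `dist x y ≥ 2ε`. -/
noncomputable def fker (ε : ℝ) (x y : X) : ℝ :=
  if dist x y ≤ ε then 1 else if dist x y ≤ 2 * ε then 2 - dist x y / ε else 0

/-- `f_ε(μ, x) = ∫ f^ε_x(y) dμ(y)`. -/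
noncomputable def feps (ε : ℝ) (μ : Measure X) (x : X) : ℝ := ∫ y, fker ε x y ∂μ

/-- `G` is a finite covering of `X` by open balls of radius `ε` (given by its finite set of
centers). -/
def IsBallCover (ε : ℝ) (G : Finset X) : Prop := (⋃ x ∈ G, ball x ε) = univ

/-- `S_μ(s,ε) = inf_G ∑_{x ∈ G} μ(B(x,ε))^s`, the infimum running over all finite coverings of
`X` by balls of radius `ε`. -/
noncomputable def Sfun (μ : Measure X) (s ε : ℝ) : ℝ :=
  ⨅ G : {H : Finset X // IsBallCover ε H}, ∑ x ∈ G.val, (μ (ball x ε)).toReal ^ s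

/-- `W_μ(s,ε) = inf_G ∑_{x ∈ G} f_ε(μ,x)^s`, the infimum running over all finite coverings of
`X` by balls of radius `ε`. -/
noncomputable def Wfun (μ : Measure X) (s ε : ℝ) : ℝ :=
  ⨅ G : {H : Finset X // IsBallCover ε H}, ∑ x ∈ G.val, (feps ε μ x) ^ s

/-- The regularized energy function `J_μ(q,ε) = ∫ f_ε(μ,x)^(q-1) dμ(x)`. -/
noncomputable def Jfun (μ : Measure X) (q ε : ℝ) : ℝ :=
  ∫ x, (feps ε μ x) ^ (q - 1) ∂μ

end Defs

section Shift

variable {M : Type*} [MetricSpace M]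

/-- The "cylinder ball" `B^n(x,ε) = {y | d(x_i, y_i) < ε for all |i| ≤ n}` in `M^ℤ`. -/
def cylBall (n : ℕ) (x : ℤ → M) (ε : ℝ) : Set (ℤ → M) :=
  {y : ℤ → M | ∀ i : ℤ, |i| ≤ (n : ℤ) → dist (x i) (y i) < ε}

/-- For `ε ∈ (0,1)`, the largest integer `n ≥ 0` with `ε < 1/(n²+1)`. -/
noncomputable def nZero (ε : ℝ) : ℕ := sSup {n : ℕ | ε < 1 / ((n : ℝ) ^ 2 + 1)}

/-- The modified energy function `I^n_μ(q,ε) = ∫ μ(B^n(x,ε))^(q-1) dμ(x)`. -/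
noncomputable def Icyl [MeasurableSpace (ℤ → M)] (μ : Measure (ℤ → M)) (n : ℕ) (q ε : ℝ) :
    ℝ :=
  ∫ x, (μ (cylBall n x ε)).toReal ^ (q - 1) ∂μ

end Shift


section SupportIntegral

variable {X : Type*} [MetricSpace X] [MeasurableSpace X]

theorem msupp_eq_support (μ : Measure X) : msupp μ = μ.support := by
  ext x
  exact (nhds_basis_ball.mem_measureSupport (μ := μ)).symm

theorem ae_mem_msupp [SecondCountableTopology X] (μ : Measure X) : ∀ᵐ x ∂μ, x ∈ msupp μ := by
  rw [msupp_eq_support]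
  exact Measure.support_mem_ae

theorem energyI_eq_integral [SecondCountableTopology X] (μ : Measure X) (q ε : ℝ) :
    energyI μ q ε = ∫ x, (μ (ball x ε)).toReal ^ (q - 1) ∂μ := by
  rw [energyI, Measure.restrict_eq_self_of_ae_mem (ae_mem_msupp μ)]

end SupportIntegral

theorem integrable_measure_prodMk_rpow {X : Type*} [MeasurableSpace X] (μ : Measure X)
    [IsFiniteMeasure μ] {S : Set (X × X)} (hS : MeasurableSet S) {p : ℝ} (hp : 0 ≤ p) :
    Integrable (fun x => (μ (Prod.mk x ⁻¹' S)).toReal ^ p) μ := by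
  refine Integrable.of_bound (C := (μ univ).toReal ^ p)
    ((measurable_measure_prodMk_left hS).ennreal_toReal.pow_const p).aestronglyMeasurable
    (Eventually.of_forall fun x => ?_)
  rw [Real.norm_of_nonneg (by positivity)]
  exact Real.rpow_le_rpow ENNReal.toReal_nonneg
    (ENNReal.toReal_mono (measure_ne_top _ _) (measure_mono (subset_univ _))) hp

theorem integrable_measure_ball_rpow {X : Type*} [MetricSpace X] [SecondCountableTopology X]
    [MeasurableSpace X] [BorelSpace X] (μ : Measure X) [IsFiniteMeasure μ] (ε : ℝ) {p : ℝ}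
    (hp : 0 ≤ p) : Integrable (fun x => (μ (ball x ε)).toReal ^ p) μ :=
  integrable_measure_prodMk_rpow μ (S := {z : X × X | dist z.2 z.1 < ε})
    (isOpen_lt (by fun_prop) (by fun_prop)).measurableSet hp

theorem energyI_pos {X : Type*} [MetricSpace X] [SecondCountableTopology X] [MeasurableSpace X]
    [BorelSpace X] (μ : Measure X) [IsFiniteMeasure μ] [NeZero μ] {q ε : ℝ} (hq : 1 ≤ q)
    (hε : 0 < ε) : 0 < energyI μ q ε := by
  rw [energyI_eq_integral, integral_pos_iff_support_of_nonneg (fun x => by positivity)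
    (integrable_measure_ball_rpow μ ε (sub_nonneg.2 hq))]
  have hsub : msupp μ ⊆ Function.support fun x => (μ (ball x ε)).toReal ^ (q - 1) := fun x hx =>
    (Real.rpow_pos_of_pos (ENNReal.toReal_pos (hx ε hε).ne' (measure_ne_top _ _)) _).ne'
  have hae : (Function.support fun x => (μ (ball x ε)).toReal ^ (q - 1)) =ᵐ[μ] univ :=
    eventuallyEq_univ.2 (mem_of_superset (ae_mem_msupp μ) hsub)
  rw [measure_congr hae]
  exact NeZero.pos _

theorem measurableSet_mem_cylBall {M : Type*} [MetricSpace M] [CompactSpace M]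
    [MeasurableSpace (ℤ → M)] [BorelSpace (ℤ → M)] (n : ℕ) (ε : ℝ) :
    MeasurableSet {z : (ℤ → M) × (ℤ → M) | z.2 ∈ cylBall n z.1 ε} := by
  have : SecondCountableTopology M := UniformSpace.secondCountable_of_separable M
  have hS : {z : (ℤ → M) × (ℤ → M) | z.2 ∈ cylBall n z.1 ε} =
      ⋂ (i : ℤ) (_ : |i| ≤ (n : ℤ)), {z | dist (z.1 i) (z.2 i) < ε} := by
    ext z
    simp [cylBall]
  rw [hS]
  exact MeasurableSet.iInter fun i => MeasurableSet.iInter fun _ =>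
    (isOpen_lt (by fun_prop) (by fun_prop)).measurableSet

theorem summable_one_div_int_sq_add_one : Summable fun n : ℤ => 1 / ((n : ℝ) ^ 2 + 1) := by
  refine Summable.of_norm_bounded_eventually (Real.summable_one_div_int_pow.2 one_lt_two) ?_
  filter_upwards [(Set.finite_singleton (0 : ℤ)).compl_mem_cofinite] with n hn
  have hn0 : (n : ℝ) ≠ 0 := Int.cast_ne_zero.2 hn
  rw [Real.norm_of_nonneg (by positivity)]
  exact one_div_le_one_div_of_le (by positivity) (by linarith)

theorem lt_one_div_of_le_nZero {ε : ℝ} (h0 : 0 < ε) (h1 : ε < 1) {k : ℝ}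
    (hk : |k| ≤ nZero ε) : ε < 1 / (k ^ 2 + 1) := by
  have hne : {n : ℕ | ε < 1 / ((n : ℝ) ^ 2 + 1)}.Nonempty := ⟨0, by simpa using h1⟩
  have hbdd : BddAbove {n : ℕ | ε < 1 / ((n : ℝ) ^ 2 + 1)} := by
    obtain ⟨N, hN⟩ := exists_nat_gt (1 / ε)
    refine ⟨N, fun n hn => ?_⟩
    by_contra! hlt
    have hn1 : (1 : ℝ) ≤ n := by exact_mod_cast (Nat.zero_le N).trans_lt hlt
    have hlt' : (N : ℝ) < n := by exact_mod_cast hlt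
    have hn' : (n : ℝ) ^ 2 + 1 < 1 / ε := (lt_one_div h0 (by positivity)).1 hn
    nlinarith
  have hmem : ε < 1 / ((nZero ε : ℝ) ^ 2 + 1) := Nat.sSup_mem hne hbdd
  refine hmem.trans_le (one_div_le_one_div_of_le (by positivity) ?_)
  have := sq_le_sq' (by linarith [neg_le_of_abs_le hk, abs_nonneg k]) (le_of_abs_le hk)
  linarith

section SumMetric

variable {M : Type*} [MetricSpace M]

theorem summable_min_dist (x y : ℤ → M) :
    Summable fun n : ℤ => min (1 / ((n : ℝ) ^ 2 + 1)) (dist (x n) (y n)) :=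
  Summable.of_nonneg_of_le (fun n => le_min (by positivity) dist_nonneg)
    (fun n => min_le_left _ _) summable_one_div_int_sq_add_one

theorem min_dist_le_tsum (x y : ℤ → M) (n : ℤ) :
    min (1 / ((n : ℝ) ^ 2 + 1)) (dist (x n) (y n)) ≤
      ∑' n : ℤ, min (1 / ((n : ℝ) ^ 2 + 1)) (dist (x n) (y n)) :=
  (summable_min_dist x y).le_tsum n fun _ _ => le_min (by positivity) dist_nonneg

variable [mX : MetricSpace (ℤ → M)]

theorem ball_subset_cylBall
    (hr : ∀ x y : ℤ → M,
      dist x y = ∑' n : ℤ, min (1 / ((n : ℝ) ^ 2 + 1)) (dist (x n) (y n)))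
    {ε : ℝ} (h0 : 0 < ε) (h1 : ε < 1) (x : ℤ → M) : ball x ε ⊆ cylBall (nZero ε) x ε := by
  intro y hy i hi
  have hy' : dist x y < ε := mem_ball'.1 hy
  rw [hr] at hy'
  have hk : |(i : ℝ)| ≤ nZero ε := by exact_mod_cast hi
  exact (min_lt_iff.1 ((min_dist_le_tsum x y i).trans_lt hy')).resolve_left
    (lt_one_div_of_le_nZero h0 h1 hk).not_gt

theorem toTopologicalSpace_eq_pi
    (hr : ∀ x y : ℤ → M,
      dist x y = ∑' n : ℤ, min (1 / ((n : ℝ) ^ 2 + 1)) (dist (x n) (y n))) :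
    mX.toUniformSpace.toTopologicalSpace = Pi.topologicalSpace := by
  refine TopologicalSpace.ext_nhds fun x => le_antisymm ?_ ?_
  · rw [nhds_pi, le_pi]
    intro i
    change Tendsto (fun y : ℤ → M => y i) _ _
    rw [nhds_basis_ball.tendsto_iff nhds_basis_ball]
    intro δ hδ
    have hi : (0 : ℝ) < 1 / ((i : ℝ) ^ 2 + 1) := by positivity
    refine ⟨min (1 / ((i : ℝ) ^ 2 + 1)) δ, lt_min hi hδ, fun y hy => ?_⟩
    have hy' : dist x y < min (1 / ((i : ℝ) ^ 2 + 1)) δ := mem_ball'.1 hy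
    rw [hr] at hy'
    have hlt := (min_dist_le_tsum x y i).trans_lt hy'
    rw [mem_ball']
    have h := (min_lt_iff.1 (hlt.trans_le (min_le_left _ _))).resolve_left (lt_irrefl _)
    exact (min_eq_right h.le).symm.trans_lt (hlt.trans_le (min_le_right _ _))
  · rw [nhds_basis_ball.ge_iff]
    intro δ hδ
    have hcont : Continuous fun y : ℤ → M =>
        ∑' n : ℤ, min (1 / ((n : ℝ) ^ 2 + 1)) (dist (x n) (y n)) :=
      continuous_tsum (fun n => by fun_prop) summable_one_div_int_sq_add_one fun n y => by
        rw [Real.norm_of_nonneg (le_min (by positivity) dist_nonneg)]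
        exact min_le_left _ _
    have hx : ∑' n : ℤ, min (1 / ((n : ℝ) ^ 2 + 1)) (dist (x n) (x n)) < δ := by
      rwa [← hr, dist_self]
    filter_upwards [hcont.continuousAt.eventually_lt_const hx] with y hy
    rwa [mem_ball', hr]

theorem energyI_le_Icyl [CompactSpace M]
    (hr : ∀ x y : ℤ → M,
      dist x y = ∑' n : ℤ, min (1 / ((n : ℝ) ^ 2 + 1)) (dist (x n) (y n)))
    [MeasurableSpace (ℤ → M)] [BorelSpace (ℤ → M)]
    [@SecondCountableTopology (ℤ → M) mX.toUniformSpace.toTopologicalSpace]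
    (μ : Measure (ℤ → M)) [IsFiniteMeasure μ] {q ε : ℝ} (hq : 1 ≤ q) (h0 : 0 < ε) (h1 : ε < 1) :
    energyI μ q ε ≤ Icyl μ (nZero ε) q ε := by
  have hb : @BorelSpace (ℤ → M) mX.toUniformSpace.toTopologicalSpace _ := by
    rwa [toTopologicalSpace_eq_pi hr]
  rw [energyI_eq_integral, Icyl]
  have hq' : 0 ≤ q - 1 := sub_nonneg.2 hq
  exact integral_mono (integrable_measure_ball_rpow μ ε hq')
    (integrable_measure_prodMk_rpow μ (measurableSet_mem_cylBall (nZero ε) ε) hq') fun x =>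
    Real.rpow_le_rpow ENNReal.toReal_nonneg (ENNReal.toReal_mono (measure_ne_top _ _)
      (measure_mono (ball_subset_cylBall hr h0 h1 x))) hq'

end SumMetric

/-- For `X = M^ℤ` (with `M` compact metric) with the metric
`r(x,y) = ∑_{n∈ℤ} min (1/(n²+1)) (d(xₙ,yₙ))`, a Borel probability measure `μ` on `X` and
`q > 1`: `D⁺_μ(q) ≥ limsup_{ε→0⁺} log I^{n₀(ε)}_μ(q,ε) / ((q-1) log ε)`, where `n₀(ε)` is the
largest integer `n` with `ε < 1/(n²+1)` and `I^n_μ(q,ε) = ∫ μ(B^n(x,ε))^(q-1) dμ(x)`. -/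
theorem statement17 {M : Type*} [MetricSpace M] [CompactSpace M]
    [mX : MetricSpace (ℤ → M)]
    (hr : ∀ x y : ℤ → M,
      dist x y = ∑' n : ℤ, min (1 / ((n : ℝ) ^ 2 + 1)) (dist (x n) (y n)))
    [MeasurableSpace (ℤ → M)] [BorelSpace (ℤ → M)]
    (μ : Measure (ℤ → M)) [IsProbabilityMeasure μ] (q : ℝ) (hq : 1 < q) :
    limsup (fun ε : ℝ =>
        ((Real.log (Icyl μ (nZero ε) q ε) / ((q - 1) * Real.log ε) : ℝ) : EReal))
      (𝓝[>] (0 : ℝ)) ≤ Dupper μ q := by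
  have htop := toTopologicalSpace_eq_pi hr
  have : SecondCountableTopology M := UniformSpace.secondCountable_of_separable M
  have hsc : @SecondCountableTopology (ℤ → M) mX.toUniformSpace.toTopologicalSpace := by
    rw [htop]
    infer_instance
  have hb : @BorelSpace (ℤ → M) mX.toUniformSpace.toTopologicalSpace _ := by
    rwa [htop]
  refine limsup_le_limsup ?_
  filter_upwards [Ioo_mem_nhdsGT (zero_lt_one' ℝ)] with ε hε
  have hlog : (q - 1) * Real.log ε < 0 :=
    mul_neg_of_pos_of_neg (sub_pos.2 hq) (Real.log_neg hε.1 hε.2)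
  exact EReal.coe_le_coe_iff.2 (div_le_div_of_nonpos_of_le hlog.le
    (Real.log_le_log (energyI_pos μ hq.le hε.1) (energyI_le_Icyl hr μ hq.le hε.1 hε.2)))
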